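/- arXiv:1601.02084 — 2 statements merged into one kernel-verified Lean document; each statement's English description precedes it below -/
import Mathlib

section
/- Let a, b be real with a > 0, b > 0 and a⁵ > 49·b⁵. If (x, y, z, w) is a singular point of the affine quintic, then x·y·z·w = 0. -/
/-- The auxiliary cubic `φ_c(u,v,t) = (u+v)^3 + 3uv(u+v) + c t^3`. -/
noncomputable def phi (c u v t : ℂ) : ℂ := (u + v) ^ 3 + 3 * u * v * (u + v) + c * t ^ 3

/-- The quintic `F = xw φ_a(x,w,t) - yz φ_b(y,z,t)`. -/
noncomputable def F (a b : ℝ) (x y z w t : ℂ) : ℂ :=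
  x * w * phi (a : ℂ) x w t - y * z * phi (b : ℂ) y z t

/-- `(x,y,z,w)` is a singular point of the affine quintic `F(·,·,·,·,1) = 0`. -/
def IsSingularPoint (a b : ℝ) (x y z w : ℂ) : Prop :=
  F a b x y z w 1 = 0 ∧
  deriv (fun s => F a b s y z w 1) x = 0 ∧
  deriv (fun s => F a b x s z w 1) y = 0 ∧
  deriv (fun s => F a b x y s w 1) z = 0 ∧
  deriv (fun s => F a b x y z s 1) w = 0

/-- The partial derivative of `u v φ_c(u,v,1)` in the variable `u`. -/
lemma hasDerivAt_mul_phi (c u v : ℂ) :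
    HasDerivAt (fun s => s * v * phi c s v 1)
      (v * (phi c u v 1 + u * (3 * (u + v) ^ 2 + 3 * u * v + 3 * v * (u + v)))) u := by
  have h1 : HasDerivAt (fun s : ℂ => s) 1 u := hasDerivAt_id u
  have h := (h1.mul_const v).mul
    ((((h1.add_const v).pow 3).add (((h1.const_mul 3).mul_const v).mul (h1.add_const v))).add_const
      (c * 1 ^ 3))
  refine h.congr_deriv ?_
  simp only [phi, Pi.add_apply, Pi.mul_apply, Pi.pow_apply]
  push_cast
  ring

lemma phi_comm (c u v t : ℂ) : phi c u v t = phi c v u t := by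
  unfold phi; ring

/-- The cubes of the critical values of `u v φ_c(u,v,1)` at critical points with `u v ≠ 0`. -/
lemma mul_phi_pow_three_of_critical {c u v : ℂ} (hu : u ≠ 0) (hv : v ≠ 0)
    (hdu : deriv (fun s => s * v * phi c s v 1) u = 0)
    (hdv : deriv (fun s => u * s * phi c u s 1) v = 0) :
    35 ^ 5 * (u * v * phi c u v 1) ^ 3 = 21 ^ 3 * c ^ 5 ∨
      35 ^ 5 * (u * v * phi c u v 1) ^ 3 = -49 * 21 ^ 3 * c ^ 5 := by
  have hswap : (fun s => u * s * phi c u s 1) = fun s => s * u * phi c s u 1 := by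
    funext s; rw [phi_comm]; ring
  rw [(hasDerivAt_mul_phi c u v).deriv] at hdu
  rw [hswap, (hasDerivAt_mul_phi c v u).deriv] at hdv
  have e1 := (mul_eq_zero.mp hdu).resolve_left hv
  have e2 := (mul_eq_zero.mp hdv).resolve_left hu
  simp only [phi] at e1 e2 ⊢
  have h : (u - v) * ((u + v) ^ 2 + u * v) = 0 := by linear_combination (e1 - e2) / 3
  rcases mul_eq_zero.mp h with h | h
  · left
    obtain rfl : u = v := sub_eq_zero.mp h
    have hc : c = -35 * u ^ 3 := by linear_combination e1
    rw [hc]; ring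
  · right
    have hp : u * v = -(u + v) ^ 2 := by linear_combination h
    have hc : c = 5 * (u + v) ^ 3 := by
      linear_combination e1 - (3 * u + 6 * (u + v)) * h
    have hf : u * v * ((u + v) ^ 3 + 3 * u * v * (u + v) + c * 1 ^ 3) = -3 * (u + v) ^ 5 := by
      rw [mul_assoc 3 u v, hp, hc]; ring
    rw [hf, hc]; ring

/-- If `a, b > 0` and `a⁵ > 49 b⁵`, any singular point of the affine quintic
satisfies `xyzw = 0`. -/
theorem singular_point_prod_eq_zero (a b : ℝ) (ha : 0 < a) (hb : 0 < b)
    (hab : a ^ 5 > 49 * b ^ 5) (x y z w : ℂ)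
    (h : IsSingularPoint a b x y z w) :
    x * y * z * w = 0 := by
  obtain ⟨h0, hx, hy, hz, hw⟩ := h
  by_contra hne
  simp only [mul_eq_zero, not_or] at hne
  obtain ⟨⟨⟨hx0, hy0⟩, hz0⟩, hw0⟩ := hne
  simp only [F, deriv_sub_const_fun, deriv_const_sub, neg_eq_zero] at h0 hx hy hz hw
  have hA := mul_phi_pow_three_of_critical hx0 hw0 hx hw
  have hB := mul_phi_pow_three_of_critical hy0 hz0 hy hz
  rw [sub_eq_zero.mp h0] at hA
  have ha5 : 0 < a ^ 5 := by positivity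
  have hb5 : 0 < b ^ 5 := by positivity
  rcases hA with hA | hA <;> rcases hB with hB | hB <;> rw [hA] at hB <;> norm_cast at hB <;>
    push_cast [Int.cast_negSucc] at hB <;> linarith
end

section
/- Let a, b be real with a > 0 and b > 0, and let (x, y, z, w) ∈ ℂ⁴ satisfy x·w = 0, y·z = 0, x·(x³+a) = 0, w·(w³+a) = 0, y·(y³+b) = 0 and z·(z³+b) = 0. Then the 4×4 complex Hessian matrix of g(x,y,z,w) := F(x,y,z,w,1) at this point — the matrix whose (i,j) entry is the iterated complex partial derivative of g in the i-th and j-th of the coordinates (x,y,z,w) — has nonzero determinant. (Thus every singular point of the affine quintic is a nondegenerate critical point of g, i.e. an ordinary double point.) -/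
/-- The complex partial derivative of `g : ℂ⁴ → ℂ` in the `i`-th coordinate:
the derivative of the one-variable function obtained by fixing the other
coordinates. -/
noncomputable def partialDeriv (i : Fin 4) (g : (Fin 4 → ℂ) → ℂ) : (Fin 4 → ℂ) → ℂ :=
  fun p => deriv (fun s => g (Function.update p i s)) (p i)

/-- A partial derivative is computed from the derivatives along the coordinate lines. -/
theorem partialDeriv_eq_of_hasDerivAt {i : Fin 4} {g g' : (Fin 4 → ℂ) → ℂ}
    (h : ∀ p, HasDerivAt (fun s => g (Function.update p i s)) (g' p) (p i)) :
    partialDeriv i g = g' :=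
  funext fun p => (h p).deriv

/-- The partial derivative of `u v φ_c(u,v,1)` in `u`. -/
def quinticPartial (c u v : ℂ) : ℂ :=
  4 * u ^ 3 * v + 18 * u ^ 2 * v ^ 2 + 12 * u * v ^ 3 + v ^ 4 + c * v

/-- The second partial derivative of `u v φ_c(u,v,1)` in `u`. -/
def quinticPartialSq (u v : ℂ) : ℂ :=
  12 * u ^ 2 * v + 36 * u * v ^ 2 + 12 * v ^ 3

/-- The mixed second partial derivative of `u v φ_c(u,v,1)`. -/
def quinticPartialMixed (c u v : ℂ) : ℂ :=
  4 * u ^ 3 + 36 * u ^ 2 * v + 36 * u * v ^ 2 + 4 * v ^ 3 + c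

theorem hasDerivAt_mul_phi_left (c u v : ℂ) :
    HasDerivAt (fun s => s * v * phi c s v 1) (quinticPartial c u v) u := by
  have hs := hasDerivAt_id' u
  unfold phi
  refine ((hs.mul_const v).mul ((((hs.add_const v).pow 3).add
    (((hs.const_mul 3).mul_const v).mul (hs.add_const v))).add_const (c * 1 ^ 3))).congr_deriv ?_
  simp only [quinticPartial, Pi.add_apply, Pi.mul_apply, Pi.pow_apply]
  push_cast
  ring

theorem hasDerivAt_mul_phi_right (c u v : ℂ) :
    HasDerivAt (fun s => u * s * phi c u s 1) (quinticPartial c v u) v := by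
  refine (hasDerivAt_mul_phi_left c v u).congr_of_eventuallyEq (.of_forall fun s => ?_)
  simp only [phi]
  ring

theorem hasDerivAt_quinticPartial_left (c u v : ℂ) :
    HasDerivAt (fun s => quinticPartial c s v) (quinticPartialSq u v) u := by
  have hs := hasDerivAt_id' u
  unfold quinticPartial
  refine (((((((hs.pow 3).const_mul 4).mul_const v).add
    (((hs.pow 2).const_mul 18).mul_const (v ^ 2))).add
    ((hs.const_mul 12).mul_const (v ^ 3))).add_const (v ^ 4)).add_const (c * v)).congr_deriv ?_
  simp only [quinticPartialSq]
  push_cast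
  ring

theorem hasDerivAt_quinticPartial_right (c u v : ℂ) :
    HasDerivAt (fun s => quinticPartial c u s) (quinticPartialMixed c u v) v := by
  have hs := hasDerivAt_id' v
  unfold quinticPartial
  refine (((((hs.const_mul (4 * u ^ 3)).add
    ((hs.pow 2).const_mul (18 * u ^ 2))).add
    ((hs.pow 3).const_mul (12 * u))).add (hs.pow 4)).add (hs.const_mul c)).congr_deriv ?_
  simp only [quinticPartialMixed]
  push_cast
  ring

theorem quinticPartialMixed_comm (c u v : ℂ) :
    quinticPartialMixed c u v = quinticPartialMixed c v u := by
  simp only [quinticPartialMixed]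
  ring

/-- The gradient of the affine quintic. -/
theorem partialDeriv_F (a b : ℝ) (j : Fin 4) :
    partialDeriv j (fun p => F a b (p 0) (p 1) (p 2) (p 3) 1) = fun p =>
      ![quinticPartial a (p 0) (p 3), -quinticPartial b (p 1) (p 2),
        -quinticPartial b (p 2) (p 1), quinticPartial a (p 3) (p 0)] j := by
  refine partialDeriv_eq_of_hasDerivAt fun p => ?_
  fin_cases j
  · simpa [F] using (hasDerivAt_mul_phi_left a (p 0) (p 3))
      |>.sub_const (p 1 * p 2 * phi b (p 1) (p 2) 1)
  · simpa [F] using (hasDerivAt_mul_phi_left b (p 1) (p 2))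
      |>.const_sub (p 0 * p 3 * phi a (p 0) (p 3) 1)
  · simpa [F] using (hasDerivAt_mul_phi_right b (p 1) (p 2))
      |>.const_sub (p 0 * p 3 * phi a (p 0) (p 3) 1)
  · simpa [F] using (hasDerivAt_mul_phi_right a (p 0) (p 3))
      |>.sub_const (p 1 * p 2 * phi b (p 1) (p 2) 1)

/-- The Hessian matrix of the affine quintic. -/
theorem hessian_F (a b : ℝ) (x y z w : ℂ) :
    (Matrix.of fun i j : Fin 4 =>
        partialDeriv i (partialDeriv j
          (fun p => F a b (p 0) (p 1) (p 2) (p 3) 1)) ![x, y, z, w]) =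
      !![quinticPartialSq x w, 0, 0, quinticPartialMixed a x w;
        0, -quinticPartialSq y z, -quinticPartialMixed b y z, 0;
        0, -quinticPartialMixed b y z, -quinticPartialSq z y, 0;
        quinticPartialMixed a x w, 0, 0, quinticPartialSq w x] := by
  ext i j
  rw [Matrix.of_apply, partialDeriv_F]
  fin_cases i <;> fin_cases j <;>
    simp [partialDeriv, (hasDerivAt_quinticPartial_left _ _ _).deriv,
      (hasDerivAt_quinticPartial_right _ _ _).deriv, quinticPartialMixed_comm _ w x,
      quinticPartialMixed_comm _ z y]

theorem quinticPartial_block_ne_zero {c u v : ℂ} (hc : c ≠ 0) (huv : u * v = 0)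
    (hu : u * (u ^ 3 + c) = 0) (hv : v * (v ^ 3 + c) = 0) :
    quinticPartialSq u v * quinticPartialSq v u - quinticPartialMixed c u v ^ 2 ≠ 0 := by
  have key {t : ℂ} (ht : t * (t ^ 3 + c) = 0) : 4 * t ^ 3 + c ≠ 0 := by
    rcases mul_eq_zero.1 ht with rfl | h
    · simpa using hc
    · rw [show 4 * t ^ 3 + c = -3 * c by linear_combination 4 * h]
      exact mul_ne_zero (by norm_num) hc
  rcases mul_eq_zero.1 huv with rfl | rfl
  · simpa [quinticPartialSq, quinticPartialMixed] using key hv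
  · simpa [quinticPartialSq, quinticPartialMixed] using key hu

/-- If `a, b > 0` and `(x,y,z,w)` satisfies the equations characterizing the
singular points of the affine quintic, then the 4×4 complex Hessian matrix of
`g(x,y,z,w) := F(x,y,z,w,1)` at this point has nonzero determinant; i.e. the
singular points are nondegenerate critical points (ordinary double points). -/
theorem singular_points_are_nodes (a b : ℝ) (ha : 0 < a) (hb : 0 < b) (x y z w : ℂ)
    (h1 : x * w = 0) (h2 : y * z = 0)
    (h3 : x * (x ^ 3 + (a : ℂ)) = 0) (h4 : w * (w ^ 3 + (a : ℂ)) = 0)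
    (h5 : y * (y ^ 3 + (b : ℂ)) = 0) (h6 : z * (z ^ 3 + (b : ℂ)) = 0) :
    (Matrix.of fun i j : Fin 4 =>
        partialDeriv i (partialDeriv j
          (fun p => F a b (p 0) (p 1) (p 2) (p 3) 1)) ![x, y, z, w]).det ≠ 0 := by
  rw [hessian_F]
  have h := mul_ne_zero
    (quinticPartial_block_ne_zero (Complex.ofReal_ne_zero.2 ha.ne') h1 h3 h4)
    (quinticPartial_block_ne_zero (Complex.ofReal_ne_zero.2 hb.ne') h2 h5 h6)
  convert h using 1
  simp [Matrix.det_succ_row_zero, Fin.sum_univ_succ, Fin.succAbove]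
  ring
end
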